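/- Let p be a prime and r a positive integer. In the p^r-dimensional Hilbert space with the transition matrix between two orthonormal bases being the discrete Fourier transform matrix, the set of KD-classical states equals the convex hull of the KD-classical pure states: KD^+_{A,B} = conv(pure(KD^+_{A,B})). -/

import Mathlib

open Finset Complex
open scoped ComplexOrder

/-- ω_n = e^{2πi/n} -/
noncomputable def ww (n : ℕ) : ℂ := Complex.exp (2 * Real.pi * Complex.I / n)

/-- |ψ_{m,s}⟩ = (1/√x) ∑_{k<x} ω_x^{sk} |a_{ky+m}⟩ in ℂ^d (standard basis coords). -/
noncomputable def psi (d x y m s : ℕ) : Fin d → ℂ :=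
  fun t => (1 / Real.sqrt x) *
    ∑ k ∈ Finset.range x, ww x ^ (s * k) * (if (t : ℕ) = k * y + m then 1 else 0)

/-- Fourier basis vector |b_j⟩, coordinates in the standard basis. -/
noncomputable def bvec (d j : ℕ) : Fin d → ℂ :=
  fun i => ww d ^ ((i : ℕ) * j) / Real.sqrt d

/-- rank one projection |v⟩⟨v| as a matrix. -/
noncomputable def proj {d : ℕ} (v : Fin d → ℂ) : Matrix (Fin d) (Fin d) ℂ :=
  fun i j => v i * (starRingEnd ℂ) (v j)

/-- KD quasiprobability Q_{ij}(ρ) = ⟨a_i|ρ|b_j⟩⟨b_j|a_i⟩ (standard/Fourier bases). -/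
noncomputable def KD {d : ℕ} (ρ : Matrix (Fin d) (Fin d) ℂ) (i j : Fin d) : ℂ :=
  (∑ l, ρ i l * bvec d (j : ℕ) l) * (starRingEnd ℂ) (bvec d (j : ℕ) i)

/-- The set of KD-classical pure-state projections for the DFT pair in dimension d. -/
def pureKD (d : ℕ) : Set (Matrix (Fin d) (Fin d) ℂ) :=
  {M | ∃ x y m s : ℕ, x * y = d ∧ m < y ∧ s < x ∧ M = proj (psi d x y m s)}

theorem exists_nonneg_sum_eq {I J : Type*} [Finite J] (E : ℕ → Setoid I) (F : ℕ → Setoid J)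
    (hE : Monotone E) (hF : Antitone F) (n : ℕ) (g : ℕ → I → J → ℝ)
    (hg : ∀ k i i' j j', E k i i' → F k j j' → g k i j = g k i' j')
    (h0 : ∀ i j, 0 ≤ ∑ k ∈ range (n + 1), g k i j) :
    ∃ g' : ℕ → I → J → ℝ, (∀ k ≤ n, ∀ i j, 0 ≤ g' k i j) ∧
      (∀ k i i' j j', E k i i' → F k j j' → g' k i j = g' k i' j') ∧
      ∀ i j, ∑ k ∈ range (n + 1), g' k i j = ∑ k ∈ range (n + 1), g k i j := by
  induction n generalizing g with
  | zero => exact ⟨g, by simpa using h0, hg, fun _ _ => rfl⟩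
  | succ n ih =>
    let G : I → J → ℝ := fun i j => ⨅ t : {t // F n t j}, g (n + 1) i t
    have hGle : ∀ i j, G i j ≤ g (n + 1) i j := fun i j =>
      ciInf_le (Set.finite_range fun t : {t // F n t j} => g (n + 1) i t).bddBelow
        ⟨j, (F n).refl j⟩
    have hGex : ∀ i j, ∃ t, F n t j ∧ G i j = g (n + 1) i t := fun i j => by
      have : Nonempty {t // F n t j} := ⟨⟨j, (F n).refl j⟩⟩
      obtain ⟨t, ht⟩ := exists_eq_ciInf_of_finite (f := fun t : {t // F n t j} => g (n + 1) i t)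
      exact ⟨t, t.2, ht.symm⟩
    have hGle' : ∀ i i' j j', E (n + 1) i i' → F n j j' → G i j ≤ G i' j' :=
        fun i i' j j' hi hj => by
      obtain ⟨t, ht, hGt⟩ := hGex i' j'
      rw [hGt, ← hg (n + 1) i i' t t hi ((F _).refl t)]
      exact ciInf_le (Set.finite_range fun t : {t // F n t j} => g (n + 1) i t).bddBelow
        ⟨t, (F n).trans ht ((F n).symm hj)⟩
    have hG : ∀ i i' j j', E (n + 1) i i' → F n j j' → G i j = G i' j' := fun i i' j j' hi hj =>
      le_antisymm (hGle' _ _ _ _ hi hj) (hGle' _ _ _ _ ((E _).symm hi) ((F _).symm hj))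
    have hsum : ∀ (u : I → J → ℝ) (f : ℕ → I → J → ℝ) i j,
        ∑ k ∈ range (n + 1), Function.update f n (fun i j => f n i j + u i j) k i j
          = (∑ k ∈ range (n + 1), f k i j) + u i j := fun u f i j => by
      rw [sum_range_succ, sum_range_succ, Function.update_self, ← add_assoc]
      congr 2
      refine sum_congr rfl fun k hk => ?_
      rw [Function.update_of_ne (Finset.mem_range.1 hk).ne]
    obtain ⟨g', h1, h2, h3⟩ := ih (Function.update g n fun i j => g n i j + G i j)
      (fun k i i' j j' hi hj => by
        rcases eq_or_ne k n with rfl | hk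
        · rw [Function.update_self]
          rw [hg _ _ _ _ _ hi hj, hG _ _ _ _ (hE k.le_succ hi) hj]
        · rw [Function.update_of_ne hk]
          exact hg _ _ _ _ _ hi hj)
      (fun i j => by
        rw [hsum]
        obtain ⟨t, ht, hGt⟩ := hGex i j
        have := h0 i t
        rw [sum_range_succ, ← hGt] at this
        convert this using 2
        refine sum_congr rfl fun k hk => hg _ _ _ _ _ ((E k).refl i) ?_
        exact hF (Nat.lt_succ_iff.1 (Finset.mem_range.1 hk)) ((F n).symm ht))
    refine ⟨Function.update g' (n + 1) fun i j => g (n + 1) i j - G i j, ?_, ?_, ?_⟩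
    · intro k hk i j
      rcases eq_or_ne k (n + 1) with rfl | hk'
      · rw [Function.update_self]
        exact sub_nonneg.2 (hGle i j)
      · rw [Function.update_of_ne hk']
        exact h1 k (by omega) i j
    · intro k i i' j j' hi hj
      rcases eq_or_ne k (n + 1) with rfl | hk'
      · rw [Function.update_self]
        rw [hg _ _ _ _ _ hi hj, hG _ _ _ _ hi (hF n.le_succ hj)]
      · rw [Function.update_of_ne hk']
        exact h2 _ _ _ _ _ hi hj
    · intro i j
      rw [sum_range_succ, sum_range_succ _ (n + 1), Function.update_self]
      have : ∑ k ∈ range (n + 1), Function.update g' (n + 1) (fun i j => g (n + 1) i j - G i j)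
          k i j = ∑ k ∈ range (n + 1), g' k i j := sum_congr rfl fun k hk => by
        rw [Function.update_of_ne (Finset.mem_range.1 hk).ne]
      rw [this, h3, hsum]
      ring

theorem ww_pow (d : ℕ) [NeZero d] (n : ℕ) : ww d ^ n = ZMod.stdAddChar (n : ZMod d) := by
  have := ZMod.stdAddChar_coe (N := d) (n : ℤ)
  push_cast at this
  rw [this, ww, ← Complex.exp_nat_mul]
  congr 1
  ring

theorem conj_stdAddChar {d : ℕ} [NeZero d] (a : ZMod d) :
    (starRingEnd ℂ) (ZMod.stdAddChar a) = ZMod.stdAddChar (-a) :=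
  (AddChar.map_neg_eq_conj _ a).symm

theorem bvec_eq {d : ℕ} [NeZero d] (j : ℕ) (i : Fin d) :
    bvec d j i = ZMod.stdAddChar ((i : ℕ) * j : ZMod d) / Real.sqrt d := by
  rw [bvec, ww_pow, Nat.cast_mul]

theorem ofReal_sqrt_mul_self (n : ℕ) : (Real.sqrt n : ℂ) * Real.sqrt n = n := by
  rw [← Complex.ofReal_mul, Real.mul_self_sqrt n.cast_nonneg, Complex.ofReal_natCast]

theorem KD_eq {d : ℕ} [NeZero d] (ρ : Matrix (Fin d) (Fin d) ℂ) (i j : Fin d) :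
    KD ρ i j = (∑ l, ρ i l *
      ZMod.stdAddChar ((((l : ℕ) : ZMod d) - ((i : ℕ) : ZMod d)) * ((j : ℕ) : ZMod d))) / d := by
  rw [KD, sum_mul, sum_div]
  refine sum_congr rfl fun l _ => ?_
  rw [bvec_eq, bvec_eq, map_div₀, conj_stdAddChar, Complex.conj_ofReal, sub_mul,
    sub_eq_add_neg, AddChar.map_add_eq_mul, ← ofReal_sqrt_mul_self d]
  ring

/-- `KD` as a real-linear map. -/
noncomputable def KDLinear (d : ℕ) : Matrix (Fin d) (Fin d) ℂ →ₗ[ℝ] Fin d → Fin d → ℂ where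
  toFun := KD
  map_add' ρ σ := by
    ext i j
    simp [KD, add_mul, sum_add_distrib]
  map_smul' c ρ := by
    ext i j
    simp [KD, mul_sum, sum_mul, mul_assoc]

/-- The equivalence sending a residue class to its least representative. -/
def zmodEquivFin (d : ℕ) [NeZero d] : ZMod d ≃ Fin d where
  toFun a := ⟨a.val, a.val_lt⟩
  invFun i := (i : ℕ)
  left_inv a := by simp
  right_inv i := by ext; simp [ZMod.val_cast_of_lt i.2]

theorem natCast_zmodEquivFin {d : ℕ} [NeZero d] (a : ZMod d) :
    ((zmodEquivFin d a : ℕ) : ZMod d) = a := (zmodEquivFin d).left_inv a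

theorem zmodEquivFin_natCast {d : ℕ} [NeZero d] (i : Fin d) :
    zmodEquivFin d (i : ℕ) = i := (zmodEquivFin d).right_inv i

theorem eq_of_sum_mul_stdAddChar_eq {d : ℕ} [NeZero d] {f g : ZMod d → ℂ}
    (h : ∀ j, ∑ δ, f δ * ZMod.stdAddChar (δ * j) = ∑ δ, g δ * ZMod.stdAddChar (δ * j)) :
    f = g := by
  apply (ZMod.dft (N := d) (E := ℂ)).injective
  ext k
  simpa [ZMod.dft_apply, mul_comm] using h (-k)

theorem KD_zmodEquivFin {d : ℕ} [NeZero d] (ρ : Matrix (Fin d) (Fin d) ℂ) (a b : ZMod d) :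
    KD ρ (zmodEquivFin d a) (zmodEquivFin d b) =
      (∑ δ, ρ (zmodEquivFin d a) (zmodEquivFin d (a + δ)) * ZMod.stdAddChar (δ * b)) / d := by
  rw [KD_eq, ← (zmodEquivFin d).sum_comp, ← Equiv.sum_comp (Equiv.addLeft a)]
  simp [natCast_zmodEquivFin]

theorem KD_injective {d : ℕ} [NeZero d] :
    Function.Injective (KD : Matrix (Fin d) (Fin d) ℂ → Fin d → Fin d → ℂ) := by
  intro ρ σ h
  ext i l
  have hd : (d : ℂ) ≠ 0 := NeZero.ne _
  have key := eq_of_sum_mul_stdAddChar_eq (d := d)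
    (f := fun δ => ρ (zmodEquivFin d (i : ℕ)) (zmodEquivFin d ((i : ℕ) + δ)))
    (g := fun δ => σ (zmodEquivFin d (i : ℕ)) (zmodEquivFin d ((i : ℕ) + δ))) fun j => by
      have := congrFun (congrFun h (zmodEquivFin d (i : ℕ))) (zmodEquivFin d j)
      rwa [KD_zmodEquivFin, KD_zmodEquivFin, div_left_inj' hd] at this
  have := congrFun key ((l : ℕ) - (i : ℕ))
  simpa [zmodEquivFin_natCast] using this

theorem apply_add_eq_of_KD_real {d : ℕ} [NeZero d] {ρ : Matrix (Fin d) (Fin d) ℂ}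
    (hρ : ρ.IsHermitian) (h : ∀ i j, (starRingEnd ℂ) (KD ρ i j) = KD ρ i j) (a δ : ZMod d) :
    ρ (zmodEquivFin d a) (zmodEquivFin d (a + δ)) =
      ρ (zmodEquivFin d (a - δ)) (zmodEquivFin d a) := by
  have hd : (d : ℂ) ≠ 0 := NeZero.ne _
  refine congrFun (eq_of_sum_mul_stdAddChar_eq (d := d)
    (f := fun δ => ρ (zmodEquivFin d a) (zmodEquivFin d (a + δ)))
    (g := fun δ => ρ (zmodEquivFin d (a - δ)) (zmodEquivFin d a)) fun j => ?_) δ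
  have := h (zmodEquivFin d a) (zmodEquivFin d j)
  rw [KD_zmodEquivFin, map_div₀, Complex.conj_natCast, div_left_inj' hd] at this
  rw [← this, map_sum, ← Equiv.sum_comp (Equiv.neg _)]
  refine sum_congr rfl fun t _ => ?_
  rw [map_mul, conj_stdAddChar, Equiv.neg_apply, neg_mul, neg_neg, ← sub_eq_add_neg,
    ← hρ.apply (zmodEquivFin d (a - t))]
  rfl

theorem apply_add_eq_of_KD_real_shift {d : ℕ} [NeZero d] {ρ : Matrix (Fin d) (Fin d) ℂ}
    (hρ : ρ.IsHermitian) (h : ∀ i j, (starRingEnd ℂ) (KD ρ i j) = KD ρ i j) (a δ : ZMod d)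
    (n : ℕ) :
    ρ (zmodEquivFin d (a + n * δ)) (zmodEquivFin d (a + n * δ + δ)) =
      ρ (zmodEquivFin d a) (zmodEquivFin d (a + δ)) := by
  induction n with
  | zero => simp
  | succ n ih =>
    rw [← ih, apply_add_eq_of_KD_real hρ h (a + (n + 1 : ℕ) * δ)]
    congr 2 <;> · push_cast; ring

theorem isPrimitiveRoot_ww {x : ℕ} (hx : x ≠ 0) : IsPrimitiveRoot (ww x) x :=
  Complex.isPrimitiveRoot_exp x hx

theorem ww_pow_eq_pow_iff {x a b : ℕ} (hx : x ≠ 0) : ww x ^ a = ww x ^ b ↔ a % x = b % x := by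
  have h := isPrimitiveRoot_ww hx
  have := (h.isOfFinOrder hx).pow_eq_pow_iff_modEq (n := a) (m := b)
  rwa [← h.eq_orderOf] at this

theorem ww_mul_pow {x y : ℕ} (hy : y ≠ 0) : ww (x * y) ^ y = ww x := by
  rw [ww, ww, ← Complex.exp_nat_mul]
  congr 1
  have : (y : ℂ) ≠ 0 := Nat.cast_ne_zero.2 hy
  push_cast
  rw [mul_div_assoc', mul_comm (x : ℂ), mul_div_mul_left _ _ this]

theorem psi_apply {d x y m s : ℕ} (hd : x * y = d) (hm : m < y) (t : Fin d) :
    psi d x y m s t =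
      if (t : ℕ) % y = m then (1 / Real.sqrt x) * ww x ^ (s * ((t : ℕ) / y)) else 0 := by
  have hy : 0 < y := m.zero_le.trans_lt hm
  have key : ∀ k, (t : ℕ) = k * y + m ↔ k = (t : ℕ) / y ∧ (t : ℕ) % y = m := fun k => by
    constructor
    · intro h
      rw [h, add_comm, Nat.add_mul_div_right _ _ hy, Nat.div_eq_of_lt hm,
        Nat.add_mul_mod_self_right,
        Nat.mod_eq_of_lt hm]
      simp
    · rintro ⟨rfl, h⟩
      rw [← h, Nat.div_add_mod']
  have ht : (t : ℕ) / y < x := (Nat.div_lt_iff_lt_mul hy).2 (hd ▸ t.2)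
  simp only [psi, key]
  split_ifs with h
  · simp [h, ht]
  · simp [h]

theorem sum_conj_psi_mul {d x y m s : ℕ} (hd : x * y = d) (hm : m < y) (F : ℕ → ℂ) :
    ∑ t : Fin d, (starRingEnd ℂ) (psi d x y m s t) * F t =
      (1 / Real.sqrt x) * ∑ k ∈ range x, (starRingEnd ℂ) (ww x) ^ (s * k) * F (k * y + m) := by
  simp only [psi, map_mul, map_sum, mul_sum, sum_mul]
  rw [sum_comm]
  refine sum_congr rfl fun k hk => ?_
  have hlt : k * y + m < d := by
    rw [← hd]
    calc k * y + m < (k + 1) * y := by rw [add_mul]; omega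
      _ ≤ x * y := Nat.mul_le_mul_right _ (Finset.mem_range.1 hk)
  rw [Finset.sum_eq_single ⟨k * y + m, hlt⟩]
  · simp [mul_assoc]
  · intro t _ ht
    rw [if_neg fun h => ht (Fin.ext h)]
    simp
  · simp

theorem conj_ww_pow_mul_self {x : ℕ} (n : ℕ) : (starRingEnd ℂ) (ww x) ^ n * ww x ^ n = 1 := by
  have : ‖ww x‖ = 1 := by
    rw [ww, Complex.norm_exp]
    have : 2 * Real.pi * Complex.I / x = ((2 * Real.pi / x : ℝ) : ℂ) * Complex.I := by
      push_cast; ring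
    rw [this, Complex.re_ofReal_mul]
    simp
  rw [← mul_pow, ← Complex.normSq_eq_conj_mul_self, Complex.normSq_eq_norm_sq, this]
  simp

theorem KD_proj_psi {d x y m s : ℕ} (hd : x * y = d) (hm : m < y) (hs : s < x) (i j : Fin d) :
    KD (proj (psi d x y m s)) i j =
      if (i : ℕ) % y = m ∧ (j : ℕ) % x = s then 1 / (d : ℂ) else 0 := by
  have hx : x ≠ 0 := by omega
  have hy : y ≠ 0 := by omega
  have hxd : (x : ℂ) ≠ 0 := Nat.cast_ne_zero.2 hx
  have hwd : ww d ^ y = ww x := hd ▸ ww_mul_pow hy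
  have hsum : ∑ l, proj (psi d x y m s) i l * bvec d j l =
      psi d x y m s i * (1 / Real.sqrt x * (ww d ^ (m * j) / Real.sqrt d *
        ∑ k ∈ range x, (ww x ^ (j : ℕ) * (starRingEnd ℂ) (ww x) ^ s) ^ k)) := by
    simp only [proj, bvec, mul_assoc, ← mul_sum]
    rw [sum_conj_psi_mul hd hm fun t => ww d ^ (t * j) / Real.sqrt d]
    congr 2
    rw [mul_sum]
    refine sum_congr rfl fun k _ => ?_
    rw [add_mul, pow_add, show k * y * (j : ℕ) = y * (k * j) by ring, pow_mul (ww d) y, hwd,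
      mul_pow]
    ring
  rw [KD, hsum, psi_apply hd hm]
  by_cases hi : (i : ℕ) % y = m
  swap
  · simp [hi]
  rw [if_pos hi]
  by_cases hj : (j : ℕ) % x = s
  · have h1 : ww x ^ (j : ℕ) = ww x ^ s :=
      (ww_pow_eq_pow_iff hx).2 (by rw [hj, Nat.mod_eq_of_lt hs])
    have h2 : ww d ^ ((i : ℕ) * j) = ww x ^ (s * ((i : ℕ) / y)) * ww d ^ (m * j) := by
      rw [← Nat.div_add_mod (i : ℕ) y, hi, add_mul, pow_add, mul_assoc, pow_mul (ww d) y, hwd,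
        Nat.mul_add_div (Nat.pos_of_ne_zero hy), Nat.div_eq_of_lt hm, add_zero, mul_comm _ (j : ℕ),
        pow_mul, h1, ← pow_mul]
    have h3 : (starRingEnd ℂ) (bvec d j i) =
        (starRingEnd ℂ) (ww x) ^ (s * ((i : ℕ) / y)) * (starRingEnd ℂ) (ww d) ^ (m * (j : ℕ)) /
          Real.sqrt d := by
      rw [bvec, h2, map_div₀, map_mul, map_pow, map_pow, Complex.conj_ofReal]
    have h4 : (1 / Real.sqrt x : ℂ) * (1 / Real.sqrt x) * x = 1 := by
      rw [div_mul_div_comm, ofReal_sqrt_mul_self, one_mul, one_div, inv_mul_cancel₀ hxd]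
    have h5 : (1 / Real.sqrt d : ℂ) * (1 / Real.sqrt d) = 1 / d := by
      rw [div_mul_div_comm, ofReal_sqrt_mul_self, one_mul]
    rw [if_pos ⟨hi, hj⟩, h1, mul_comm (ww x ^ s), conj_ww_pow_mul_self, h3]
    simp only [one_pow, sum_const, card_range, nsmul_eq_mul, mul_one]
    linear_combination ((1 / Real.sqrt d : ℂ) * (1 / Real.sqrt d) *
        ((starRingEnd ℂ) (ww x) ^ (s * ((i : ℕ) / y)) * ww x ^ (s * ((i : ℕ) / y))) *
        ((starRingEnd ℂ) (ww d) ^ (m * (j : ℕ)) * ww d ^ (m * (j : ℕ)))) * h4 +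
      h5 * ((starRingEnd ℂ) (ww x) ^ (s * ((i : ℕ) / y)) * ww x ^ (s * ((i : ℕ) / y))) *
        ((starRingEnd ℂ) (ww d) ^ (m * (j : ℕ)) * ww d ^ (m * (j : ℕ))) +
      (1 / d : ℂ) * ((starRingEnd ℂ) (ww d) ^ (m * (j : ℕ)) * ww d ^ (m * (j : ℕ))) *
        conj_ww_pow_mul_self (x := x) (s * ((i : ℕ) / y)) +
      (1 / d : ℂ) * conj_ww_pow_mul_self (x := d) (m * (j : ℕ))
  · rw [if_neg (by tauto)]
    have h1 : ww x ^ (j : ℕ) * (starRingEnd ℂ) (ww x) ^ s ≠ 1 := fun h => by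
      have h2 : ww x ^ (j : ℕ) = ww x ^ s := by
        linear_combination (-ww x ^ (j : ℕ)) * conj_ww_pow_mul_self (x := x) s + ww x ^ s * h
      rw [ww_pow_eq_pow_iff hx, Nat.mod_eq_of_lt hs] at h2
      exact hj h2
    have h2 : (ww x ^ (j : ℕ) * (starRingEnd ℂ) (ww x) ^ s) ^ x = 1 := by
      rw [mul_pow, ← map_pow, ← map_pow, ← pow_mul, ← pow_mul, mul_comm, mul_comm _ x,
        mul_comm _ x, pow_mul, pow_mul, (isPrimitiveRoot_ww hx).pow_eq_one]
      simp
    rw [geom_sum_eq h1, h2]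
    simp

theorem trace_proj_psi {d x y m s : ℕ} (hd : x * y = d) (hm : m < y) (hs : s < x) :
    (proj (psi d x y m s)).trace = 1 := by
  have hx : (x : ℂ) ≠ 0 := Nat.cast_ne_zero.2 (by omega)
  have hy : 0 < y := by omega
  let F : ℕ → ℂ := fun t =>
    if t % y = m then (1 / Real.sqrt x) * ww x ^ (s * (t / y)) else 0
  have hF : ∀ k, F (k * y + m) = (1 / Real.sqrt x) * ww x ^ (s * k) := fun k => by
    simp only [F]
    rw [Nat.mul_add_mod_self_right, Nat.mod_eq_of_lt hm, if_pos rfl, mul_comm k,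
      Nat.mul_add_div hy, Nat.div_eq_of_lt hm, add_zero]
  have h : (proj (psi d x y m s)).trace =
      ∑ t : Fin d, (starRingEnd ℂ) (psi d x y m s t) * F t :=
    sum_congr rfl fun t _ => by
      rw [Matrix.diag_apply, proj, mul_comm]
      congr 1
      exact psi_apply hd hm t
  rw [h, sum_conj_psi_mul hd hm]
  have : ∀ k ∈ range x, (starRingEnd ℂ) (ww x) ^ (s * k) * F (k * y + m) = 1 / Real.sqrt x :=
    fun k _ => by
      rw [hF]
      linear_combination (1 / Real.sqrt x : ℂ) * conj_ww_pow_mul_self (x := x) (s * k)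
  rw [sum_congr rfl this, sum_const, card_range, nsmul_eq_mul, mul_left_comm, div_mul_div_comm,
    ofReal_sqrt_mul_self, one_mul, mul_one_div_cancel hx]

theorem posSemidef_proj {d : ℕ} (v : Fin d → ℂ) : (proj v).PosSemidef :=
  Matrix.posSemidef_vecMulVec_self_star v

theorem exists_natCast_mul_eq {d v : ℕ} [NeZero d] {δ : ZMod d} (hv : δ.val.gcd d = v) {i i' : ℕ}
    (h : i ≡ i' [MOD v]) : ∃ n : ℕ, (i' : ZMod d) = i + n * δ := by
  obtain ⟨c, hc⟩ := h.dvd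
  have hb := congrArg (Int.cast : ℤ → ZMod d) (Nat.gcd_eq_gcd_ab δ.val d)
  have hc' := congrArg (Int.cast : ℤ → ZMod d) hc
  rw [hv] at hb
  push_cast at hb hc'
  rw [ZMod.natCast_self, ZMod.natCast_val, ZMod.cast_id', id, zero_mul, add_zero] at hb
  refine ⟨((Nat.gcdA δ.val d : ZMod d) * c).val, ?_⟩
  rw [ZMod.natCast_val, ZMod.cast_id', id]
  linear_combination hc' + c * hb

/-- Congruence modulo `n` on `Fin d`. -/
def finModSetoid (d n : ℕ) : Setoid (Fin d) := Setoid.ker fun i => (i : ℕ) % n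

theorem finModSetoid_le {d m n : ℕ} (h : m ∣ n) : finModSetoid d n ≤ finModSetoid d m :=
  fun _ _ hij => Nat.ModEq.of_dvd h hij

theorem exists_sum_eq_re_KD {p r : ℕ} (hp : p.Prime) {ρ : Matrix (Fin (p ^ r)) (Fin (p ^ r)) ℂ}
    (hρ : ρ.IsHermitian) (h : ∀ i j, (starRingEnd ℂ) (KD ρ i j) = KD ρ i j) :
    ∃ g : ℕ → Fin (p ^ r) → Fin (p ^ r) → ℝ,
      (∀ k i i' j j', finModSetoid _ (p ^ (r - k)) i i' → finModSetoid _ (p ^ k) j j' →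
        g k i j = g k i' j') ∧
      ∀ i j, ∑ k ∈ range (r + 1), g k i j = (KD ρ i j).re := by
  have : NeZero (p ^ r) := ⟨pow_ne_zero _ hp.ne_zero⟩
  have hex : ∀ δ : ZMod (p ^ r), ∃ v ≤ r, δ.val.gcd (p ^ r) = p ^ v := fun δ =>
    (Nat.dvd_prime_pow hp).1 (Nat.gcd_dvd_right _ _)
  choose v hvr hv using hex
  let T : Fin (p ^ r) → Fin (p ^ r) → ZMod (p ^ r) → ℂ := fun i j δ =>
    ρ (zmodEquivFin _ (i : ℕ)) (zmodEquivFin _ ((i : ℕ) + δ)) *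
      ZMod.stdAddChar (δ * ((j : ℕ) : ZMod (p ^ r)))
  refine ⟨fun k i j => ((∑ δ with r - v δ = k, T i j δ) / (p ^ r : ℕ)).re, ?_, ?_⟩
  · intro k i i' j j' hi hj
    dsimp only
    congr 2
    refine sum_congr rfl fun δ hδ => ?_
    have hk : r - v δ = k := (mem_filter.1 hδ).2
    have hvk : r - k = v δ := by have := hvr δ; omega
    rw [hvk] at hi
    refine congrArg₂ (· * ·) ?_ (congrArg _ ?_)
    · obtain ⟨n, hn⟩ := exists_natCast_mul_eq (hv δ) hi
      rw [hn, apply_add_eq_of_KD_real_shift hρ h]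
    · obtain ⟨c, hc⟩ := Nat.gcd_dvd_left δ.val (p ^ r)
      obtain ⟨b, hb⟩ := (show (j : ℕ) ≡ j' [MOD p ^ k] from hj).dvd
      have hb' := congrArg (Int.cast : ℤ → ZMod (p ^ r)) hb
      have hc' := congrArg (Nat.cast : ℕ → ZMod (p ^ r)) hc
      have h0 : ((p : ZMod (p ^ r)) ^ v δ) * p ^ k = 0 := by
        rw [← pow_add, show v δ + k = r by have := hvr δ; omega, ← Nat.cast_pow,
          ZMod.natCast_self]
      rw [hv, ZMod.natCast_val, ZMod.cast_id', id] at hc'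
      push_cast at hb' hc'
      linear_combination (-δ) * hb' - p ^ k * b * hc' - c * b * h0
  · intro i j
    rw [← Complex.re_sum, ← sum_div, sum_fiberwise_of_maps_to
      (fun δ _ => Finset.mem_range.2 (Nat.lt_succ_of_le (Nat.sub_le _ _)))]
    rw [← zmodEquivFin_natCast i, ← zmodEquivFin_natCast j, KD_zmodEquivFin]
    simp only [T, zmodEquivFin_natCast]

theorem convex_setOf_KD_nonneg (d : ℕ) :
    Convex ℝ {ρ : Matrix (Fin d) (Fin d) ℂ |
      ρ.PosSemidef ∧ ρ.trace = 1 ∧ ∀ i j, 0 ≤ KD ρ i j} := by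
  rintro ρ ⟨h1, h2, h3⟩ σ ⟨h1', h2', h3'⟩ a b ha hb hab
  refine ⟨(h1.smul ha).add (h1'.smul hb), ?_, fun i j => ?_⟩
  · rw [Matrix.trace_add, Matrix.trace_smul, Matrix.trace_smul, h2, h2', ← add_smul, hab, one_smul]
  · have : KD (a • ρ + b • σ) = a • KD ρ + b • KD σ := by
      change KDLinear d _ = _
      rw [map_add, map_smul, map_smul]
      rfl
    rw [this]
    exact add_nonneg (smul_nonneg ha (h3 i j)) (smul_nonneg hb (h3' i j))

theorem pureKD_subset {d : ℕ} :
    pureKD d ⊆ {ρ | ρ.PosSemidef ∧ ρ.trace = 1 ∧ ∀ i j, 0 ≤ KD ρ i j} := by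
  rintro _ ⟨x, y, m, s, hd, hm, hs, rfl⟩
  refine ⟨posSemidef_proj _, trace_proj_psi hd hm hs, fun i j => ?_⟩
  rw [KD_proj_psi hd hm hs]
  split_ifs
  · positivity
  · exact le_rfl

theorem mem_convexHull_pureKD_of_KD_eq {d n : ℕ} [NeZero d] {x y : ℕ → ℕ}
    (hxy : ∀ k ≤ n, x k * y k = d)
    {ρ : Matrix (Fin d) (Fin d) ℂ} (hρ : ρ.trace = 1) {g : ℕ → Fin d → Fin d → ℝ}
    (hg : ∀ k i i' j j', finModSetoid d (y k) i i' → finModSetoid d (x k) j j' →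
      g k i j = g k i' j')
    (hg0 : ∀ k ≤ n, ∀ i j, 0 ≤ g k i j)
    (hsum : ∀ i j, KD ρ i j = ∑ k ∈ range (n + 1), (g k i j : ℂ)) :
    ρ ∈ convexHull ℝ (pureKD d) := by
  have hd : d ≠ 0 := NeZero.ne d
  have hx : ∀ k : Fin (n + 1), x k * y k = d := fun k => hxy k (Nat.lt_succ_iff.1 k.2)
  have hxle : ∀ k : Fin (n + 1), x k ≤ d := fun k =>
    Nat.le_of_dvd (Nat.pos_of_ne_zero hd) ⟨_, (hx k).symm⟩
  have hyle : ∀ k : Fin (n + 1), y k ≤ d := fun k =>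
    Nat.le_of_dvd (Nat.pos_of_ne_zero hd) ⟨_, ((mul_comm _ _).trans (hx k)).symm⟩
  let w : (Σ k : Fin (n + 1), Fin (y k) × Fin (x k)) → ℝ := fun b =>
    d * g b.1 (Fin.castLE (hyle _) b.2.1) (Fin.castLE (hxle _) b.2.2)
  let z : (Σ k : Fin (n + 1), Fin (y k) × Fin (x k)) → Matrix (Fin d) (Fin d) ℂ := fun b =>
    proj (psi d (x b.1) (y b.1) b.2.1 b.2.2)
  have heq : ∑ b, w b • z b = ρ := by
    apply KD_injective
    change KDLinear d _ = _
    rw [map_sum]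
    ext i j
    simp only [Finset.sum_apply, map_smul, Pi.smul_apply]
    rw [hsum, ← Fin.sum_univ_eq_sum_range (fun k => (g k i j : ℂ)), Fintype.sum_sigma]
    refine sum_congr rfl fun k _ => ?_
    have hk := hx k
    have hxpos : 0 < x k := Nat.pos_of_ne_zero fun h => hd (by rw [← hk, h, zero_mul])
    have hypos : 0 < y k := Nat.pos_of_ne_zero fun h => hd (by rw [← hk, h, mul_zero])
    rw [Fintype.sum_eq_single
      ((⟨i % y k, Nat.mod_lt _ hypos⟩, ⟨j % x k, Nat.mod_lt _ hxpos⟩) : Fin (y k) × Fin (x k))]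
    · change w _ • KD (proj _) i j = _
      rw [KD_proj_psi hk (Fin.is_lt _) (Fin.is_lt _), if_pos ⟨rfl, rfl⟩]
      have : g k i j = g k (Fin.castLE (hyle k) ⟨i % y k, Nat.mod_lt _ hypos⟩)
          (Fin.castLE (hxle k) ⟨j % x k, Nat.mod_lt _ hxpos⟩) :=
        hg _ _ _ _ _ (Nat.mod_mod _ _).symm (Nat.mod_mod _ _).symm
      rw [this, Complex.real_smul]
      simp only [w]
      have : (d : ℂ) ≠ 0 := Nat.cast_ne_zero.2 hd
      push_cast
      field_simp
    · rintro ⟨a, b⟩ hab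
      change w _ • KD (proj _) i j = _
      rw [KD_proj_psi hk (Fin.is_lt _) (Fin.is_lt _), if_neg, smul_zero]
      rintro ⟨h1, h2⟩
      exact hab (Prod.ext (Fin.ext h1.symm) (Fin.ext h2.symm))
  refine mem_convexHull_of_exists_fintype w z (fun b => ?_) ?_ (fun b => ?_) heq
  · exact mul_nonneg d.cast_nonneg (hg0 _ (Nat.lt_succ_iff.1 b.1.2) _ _)
  · have htr : ∀ b, (z b).trace = 1 := fun b => trace_proj_psi (hx b.1) b.2.1.2 b.2.2.2
    rw [← heq, Matrix.trace_sum] at hρ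
    simp only [Matrix.trace_smul, htr, Complex.real_smul, mul_one] at hρ
    exact_mod_cast hρ
  · exact ⟨_, _, _, _, hx b.1, b.2.1.2, b.2.2.2, rfl⟩

/-- Theorem 1: for d = p^r, the set of KD-classical states equals
    the convex hull of the KD-classical pure-state projections. -/
theorem kd_classical_eq_convexHull_prime_power (p r : ℕ) (hp : p.Prime) (hr : 0 < r) :
    {ρ : Matrix (Fin (p ^ r)) (Fin (p ^ r)) ℂ |
        ρ.PosSemidef ∧ ρ.trace = 1 ∧ ∀ i j, 0 ≤ KD ρ i j}
    = convexHull ℝ (pureKD (p ^ r)) := by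
  have : NeZero (p ^ r) := ⟨pow_ne_zero _ hp.ne_zero⟩
  refine Set.Subset.antisymm ?_ (convexHull_min pureKD_subset (convex_setOf_KD_nonneg _))
  rintro ρ ⟨hpos, htr, hKD⟩
  obtain ⟨g, hg, hgsum⟩ := exists_sum_eq_re_KD hp hpos.isHermitian
    fun i j => Complex.conj_eq_iff_im.2 (Complex.nonneg_iff.1 (hKD i j)).2.symm
  obtain ⟨g', hg'0, hg', hg'sum⟩ := exists_nonneg_sum_eq
    (fun k => finModSetoid (p ^ r) (p ^ (r - k))) (fun k => finModSetoid (p ^ r) (p ^ k))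
    (fun a b hab => finModSetoid_le (pow_dvd_pow p (Nat.sub_le_sub_left hab r)))
    (fun a b hab => finModSetoid_le (pow_dvd_pow p hab)) r g hg
    (fun i j => (hgsum i j).symm ▸ (Complex.nonneg_iff.1 (hKD i j)).1)
  refine mem_convexHull_pureKD_of_KD_eq (n := r) (x := fun k => p ^ k) (y := fun k => p ^ (r - k))
    (fun k hk => by rw [← pow_add, Nat.add_sub_cancel' hk]) htr hg' hg'0 fun i j => ?_
  rw [← Complex.ofReal_sum, hg'sum, hgsum]
  exact Complex.ext rfl (Complex.nonneg_iff.1 (hKD i j)).2.symm
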